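/- Let f : [0,1] → ℝ be continuous and let m ≥ 1 be an integer. Then sup_{x∈[0,1]} |B_m(f;x) − f(x)| ≤ (5/2)·ω₂^σ(f; 1/√m). -/

import Mathlib

open Set Finset

/-- Bernstein basis polynomial `p_{m,k}(x) = C(m,k) x^k (1-x)^{m-k}`. -/
noncomputable def bern (m k : ℕ) (x : ℝ) : ℝ :=
  (m.choose k : ℝ) * x ^ k * (1 - x) ^ (m - k)

/-- The `m`-th Bernstein polynomial of `f`. -/
noncomputable def Bpoly (m : ℕ) (f : ℝ → ℝ) (x : ℝ) : ℝ :=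
  ∑ k ∈ Finset.range (m + 1), f ((k : ℝ) / m) * bern m k x

/-- `σ(x) = √(x(1-x))`. -/
noncomputable def sigm (x : ℝ) : ℝ := Real.sqrt (x * (1 - x))

/-- The Ditzian–Totik second modulus of smoothness of `f` with weight `σ` on `[0,1]`. -/
noncomputable def omega2DT (f : ℝ → ℝ) (δ : ℝ) : ℝ :=
  sSup {v | ∃ x h : ℝ, 0 ≤ h ∧ h ≤ δ ∧
    x - h * sigm x ∈ Set.Icc (0:ℝ) 1 ∧ x + h * sigm x ∈ Set.Icc (0:ℝ) 1 ∧
    v = |f (x + h * sigm x) - 2 * f x + f (x - h * sigm x)|}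

/-- A discrete maximum principle: if the second differences of `g` are at most `W` for all steps up
to `ρ t` and nonpositive for the step `ρ t`, then chords of `g` exceed `g` by at most `W`. -/
lemma chord_sub_le {g ρ : ℝ → ℝ} {y z W : ℝ} (hyz : y < z) (hg : ContinuousOn g (Set.Icc y z))
    (hW0 : 0 ≤ W) (hρ : ∀ t ∈ Set.Ioo y z, 0 < ρ t)
    (hW : ∀ t s, 0 ≤ s → s ≤ ρ t → y ≤ t - s → t + s ≤ z → g (t + s) - 2 * g t + g (t - s) ≤ W)
    (h0 : ∀ t, y ≤ t - ρ t → t + ρ t ≤ z → 0 < ρ t → g (t + ρ t) - 2 * g t + g (t - ρ t) ≤ 0)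
    {x : ℝ} (hx : x ∈ Set.Icc y z) :
    g y + (g z - g y) / (z - y) * (x - y) - g x ≤ W := by
  set c := (g z - g y) / (z - y) with hc
  set v : ℝ → ℝ := fun t => g y + c * (t - y) - g t with hv
  have hvc : ContinuousOn v (Set.Icc y z) := by
    apply ContinuousOn.sub _ hg
    fun_prop
  obtain ⟨t₀, ht₀, hmax⟩ := isCompact_Icc.exists_isMaxOn (Set.nonempty_Icc.2 hyz.le) hvc
  have hclosed : IsCompact (Set.Icc y z ∩ v ⁻¹' {v t₀}) :=
    isCompact_Icc.of_isClosed_subset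
      (hvc.preimage_isClosed_of_isClosed isClosed_Icc isClosed_singleton) Set.inter_subset_left
  obtain ⟨t, ⟨ht, htv⟩, hleast⟩ := hclosed.exists_isLeast ⟨t₀, ht₀, rfl⟩
  have htv : v t = v t₀ := htv
  have hle : ∀ r ∈ Set.Icc y z, v r ≤ v t := fun r hr => htv ▸ hmax hr
  have hvy : v y = 0 := by simp [hv]
  have hvz : v z = 0 := by
    have : z - y ≠ 0 := by linarith
    simp only [hv, hc]
    field_simp
    ring
  suffices h : v t ≤ W from (hle x hx).trans h
  by_contra! hlt
  have hty : y < t := lt_of_le_of_ne ht.1 (by rintro rfl; linarith)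
  have htz : t < z := lt_of_le_of_ne ht.2 (by rintro rfl; linarith)
  have hpos := hρ t ⟨hty, htz⟩
  by_cases hin : y ≤ t - ρ t ∧ t + ρ t ≤ z
  · have h1 := h0 t hin.1 hin.2 hpos
    have h2 := hle (t + ρ t) ⟨by linarith, hin.2⟩
    have h3 := hle (t - ρ t) ⟨hin.1, by linarith⟩
    have h4 : v (t - ρ t) = v t := by
      apply le_antisymm h3
      simp only [hv] at h1 h2 h3 ⊢
      linarith
    have := hleast ⟨⟨hin.1, by linarith⟩, (h4.trans htv : v (t - ρ t) = v t₀)⟩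
    linarith
  · rcases le_total (t - y) (z - t) with h | h
    · have hs : t - y ≤ ρ t := by
        by_contra! h'
        exact hin ⟨by linarith, by linarith⟩
      have h1 := hW t (t - y) (by linarith) hs (by linarith) (by linarith)
      have h2 := hle (t + (t - y)) ⟨by linarith, by linarith⟩
      rw [show t - (t - y) = y by ring] at h1
      simp only [hv] at h1 h2 hlt
      linarith
    · have hs : z - t ≤ ρ t := by
        by_contra! h'
        exact hin ⟨by linarith, by linarith⟩
      have h1 := hW t (z - t) (by linarith) hs (by linarith) (by linarith)
      have h2 := hle (t - (z - t)) ⟨by linarith, by linarith⟩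
      rw [show t + (z - t) = z by ring] at h1
      simp only [hv] at h1 h2 hlt hvz
      linarith

/-- The negative binary entropy `x log x + (1 - x) log (1 - x)`. -/
noncomputable def negEntropy (x : ℝ) : ℝ := x * Real.log x + (1 - x) * Real.log (1 - x)

lemma continuous_negEntropy : Continuous negEntropy :=
  Real.continuous_mul_log.add (Real.continuous_mul_log.comp (continuous_const.sub continuous_id))

lemma two_mul_le_log_sub_log {w : ℝ} (h0 : 0 ≤ w) (h1 : w < 1) :
    2 * w ≤ Real.log (1 + w) - Real.log (1 - w) := by
  have h := Real.hasSum_log_sub_log_of_abs_lt_one (abs_lt.2 ⟨by linarith, h1⟩)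
  have := le_hasSum h 0 (fun k _ => by positivity)
  simpa using this

lemma sq_le_mul_log_add_mul_log {w : ℝ} (h0 : 0 ≤ w) (h1 : w ≤ 1) :
    w ^ 2 ≤ (1 + w) * Real.log (1 + w) + (1 - w) * Real.log (1 - w) := by
  let F : ℝ → ℝ := fun w => (1 + w) * Real.log (1 + w) + (1 - w) * Real.log (1 - w) - w ^ 2
  have hF : Continuous F :=
    ((Real.continuous_mul_log.comp (continuous_const.add continuous_id)).add
      (Real.continuous_mul_log.comp (continuous_const.sub continuous_id))).sub
      (continuous_id.pow 2)
  have hd : ∀ r ∈ Set.Ioo (0 : ℝ) 1,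
      HasDerivAt F (Real.log (1 + r) - Real.log (1 - r) - 2 * r) r := by
    intro r hr
    have ha : HasDerivAt (fun w : ℝ => 1 + w) 1 r := (hasDerivAt_id r).const_add 1
    have hb : HasDerivAt (fun w : ℝ => 1 - w) (-1) r := (hasDerivAt_id r).const_sub 1
    have h1 : (1 + r) ≠ 0 := by linarith [hr.1]
    have h2 : (1 - r) ≠ 0 := by linarith [hr.2]
    have h := ((ha.mul (ha.log h1)).add (hb.mul (hb.log h2))).sub ((hasDerivAt_id r).pow 2)
    refine h.congr_deriv ?_
    simp
    field_simp
    ring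
  have hmono : MonotoneOn F (Set.Icc 0 1) := by
    apply monotoneOn_of_deriv_nonneg (convex_Icc 0 1) hF.continuousOn
    · rw [interior_Icc]
      exact fun r hr => (hd r hr).differentiableAt.differentiableWithinAt
    · rw [interior_Icc]
      intro r hr
      rw [(hd r hr).deriv]
      linarith [two_mul_le_log_sub_log hr.1.le hr.2]
  have := hmono ⟨le_rfl, zero_le_one⟩ ⟨h0, h1⟩ h0
  simp only [F] at this
  norm_num at this
  linarith

lemma sq_div_le_mul_log_second_diff {t s : ℝ} (ht : 0 < t) (hs : 0 ≤ s) (hst : s ≤ t) :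
    s ^ 2 / t ≤ (t + s) * Real.log (t + s) - 2 * (t * Real.log t)
      + (t - s) * Real.log (t - s) := by
  have hmul : ∀ a : ℝ, (t * a) * Real.log (t * a) = t * a * Real.log t + t * (a * Real.log a) := by
    intro a
    rcases eq_or_ne a 0 with rfl | ha
    · simp
    · rw [Real.log_mul ht.ne' ha]
      ring
  have h := mul_le_mul_of_nonneg_left
    (sq_le_mul_log_add_mul_log (div_nonneg hs ht.le) ((div_le_one ht).2 hst)) ht.le
  have ha := hmul (1 + s / t)
  have hb := hmul (1 - s / t)
  rw [show t * (1 + s / t) = t + s by field_simp] at ha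
  rw [show t * (1 - s / t) = t - s by field_simp] at hb
  rw [show t * (s / t) ^ 2 = s ^ 2 / t by field_simp] at h
  rw [ha, hb]
  linarith

lemma sq_div_le_negEntropy_second_diff {t s : ℝ} (h0 : 0 < t) (h1 : t < 1) (hs : 0 ≤ s)
    (hst : s ≤ t) (hst' : s ≤ 1 - t) :
    s ^ 2 / (t * (1 - t)) ≤ negEntropy (t + s) - 2 * negEntropy t + negEntropy (t - s) := by
  have ha := sq_div_le_mul_log_second_diff h0 hs hst
  have hb := sq_div_le_mul_log_second_diff (sub_pos.2 h1) hs hst'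
  have h2 : 1 - t ≠ 0 := by linarith
  have hsum : s ^ 2 / (t * (1 - t)) = s ^ 2 / t + s ^ 2 / (1 - t) := by
    field_simp
    ring
  simp only [negEntropy]
  rw [hsum, show 1 - (t + s) = 1 - t - s by ring, show 1 - (t - s) = 1 - t + s by ring]
  linarith

/-- The Kullback–Leibler divergence is at most the chi-squared divergence. -/
lemma negEntropy_le {x p : ℝ} (hx0 : 0 < x) (hx1 : x < 1) (hp0 : 0 ≤ p) (hp1 : p ≤ 1) :
    negEntropy p ≤ negEntropy x + (Real.log x - Real.log (1 - x)) * (p - x)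
      + (p - x) ^ 2 / (x * (1 - x)) := by
  have key : ∀ {a b : ℝ}, 0 < a → 0 ≤ b →
      b * Real.log b ≤ b * Real.log a + b * (b / a - 1) := by
    intro a b ha hb
    rcases hb.eq_or_lt with rfl | hb'
    · simp
    · have h := Real.log_le_sub_one_of_pos (div_pos hb' ha)
      rw [Real.log_div hb'.ne' ha.ne'] at h
      nlinarith
  have ha := key hx0 hp0
  have hb := key (sub_pos.2 hx1) (sub_nonneg.2 hp1)
  have h2 : 1 - x ≠ 0 := by linarith
  have hsum : (p - x) ^ 2 / (x * (1 - x)) = p * (p / x - 1) + (1 - p) * ((1 - p) / (1 - x) - 1) := by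
    field_simp
    ring
  simp only [negEntropy]
  rw [hsum]
  linarith

lemma exists_forall_le_mul_sub {G : ℝ → ℝ} {x : ℝ} (hx0 : 0 < x) (hx1 : x < 1) (hGx : G x ≤ 0)
    (hG : ∀ y z, 0 ≤ y → y < x → x < z → z ≤ 1 → (z - x) * G y + (x - y) * G z ≤ 0) :
    ∃ a, ∀ y ∈ Set.Icc (0 : ℝ) 1, G y ≤ a * (y - x) := by
  set S := (fun z => G z / (z - x)) '' Set.Ioc x 1 with hS
  have hbound : ∀ y, 0 ≤ y → y < x → ∀ r ∈ S, r ≤ -G y / (x - y) := by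
    rintro y hy0 hyx _ ⟨z, hz, rfl⟩
    have := hG y z hy0 hyx hz.1 hz.2
    rw [div_le_div_iff₀ (sub_pos.2 hz.1) (sub_pos.2 hyx)]
    linarith
  have hbdd : BddAbove S := ⟨_, hbound 0 le_rfl hx0⟩
  refine ⟨sSup S, fun y hy => ?_⟩
  rcases lt_trichotomy y x with h | rfl | h
  · have := csSup_le ⟨_, Set.mem_image_of_mem _ (Set.right_mem_Ioc.2 hx1)⟩ (hbound y hy.1 h)
    rw [le_div_iff₀ (sub_pos.2 h)] at this
    linarith
  · simpa using hGx
  · have := le_csSup hbdd (Set.mem_image_of_mem (fun z => G z / (z - x)) (⟨h, hy.2⟩ : y ∈ Set.Ioc x 1))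
    exact (div_le_iff₀ (sub_pos.2 h)).1 this

lemma bern_eq_eval (m k : ℕ) (x : ℝ) : bern m k x = (bernsteinPolynomial ℝ m k).eval x := by
  simp [bern, bernsteinPolynomial]

lemma bern_nonneg {x : ℝ} (hx : x ∈ Set.Icc (0 : ℝ) 1) (m k : ℕ) : 0 ≤ bern m k x := by
  have h0 := hx.1
  have h1 := sub_nonneg.2 hx.2
  unfold bern
  positivity

lemma sum_bern (m : ℕ) (x : ℝ) : ∑ k ∈ Finset.range (m + 1), bern m k x = 1 := by
  have h := congrArg (Polynomial.eval x) (bernsteinPolynomial.sum ℝ m)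
  simpa [Polynomial.eval_finsetSum, ← bern_eq_eval] using h

lemma sum_sub_mul_bern {m : ℕ} (hm : 1 ≤ m) (x : ℝ) :
    ∑ k ∈ Finset.range (m + 1), ((k : ℝ) / m - x) * bern m k x = 0 := by
  have hm' : (m : ℝ) ≠ 0 := by positivity
  have h := congrArg (Polynomial.eval x) (bernsteinPolynomial.sum_smul ℝ m)
  simp only [Polynomial.eval_finsetSum, nsmul_eq_mul, Polynomial.eval_mul,
    Polynomial.eval_natCast, Polynomial.eval_X, ← bern_eq_eval] at h
  simp_rw [sub_mul, Finset.sum_sub_distrib, ← Finset.mul_sum, sum_bern, div_mul_eq_mul_div,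
    ← Finset.sum_div, h]
  field_simp
  ring

lemma sum_sq_mul_bern {m : ℕ} (hm : 1 ≤ m) (x : ℝ) :
    ∑ k ∈ Finset.range (m + 1), ((k : ℝ) / m - x) ^ 2 * bern m k x = x * (1 - x) / m := by
  have hm' : (m : ℝ) ≠ 0 := by positivity
  have h := congrArg (Polynomial.eval x) (bernsteinPolynomial.variance ℝ m)
  simp [Polynomial.eval_finsetSum, ← bern_eq_eval] at h
  have h' : ∀ k ∈ Finset.range (m + 1), ((k : ℝ) / m - x) ^ 2 * bern m k x
      = (m * x - k) ^ 2 * bern m k x / (m : ℝ) ^ 2 := by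
    intro k _
    field_simp
    ring
  rw [Finset.sum_congr rfl h', ← Finset.sum_div, h]
  field_simp

lemma div_mem_Icc_of_mem_range {m k : ℕ} (hm : 1 ≤ m) (hk : k ∈ Finset.range (m + 1)) :
    (k : ℝ) / m ∈ Set.Icc (0 : ℝ) 1 := by
  have hm' : (0 : ℝ) < m := by positivity
  refine ⟨by positivity, (div_le_one hm').2 ?_⟩
  exact_mod_cast Nat.lt_succ_iff.1 (Finset.mem_range.1 hk)

lemma Bpoly_le_of_le {m : ℕ} (hm : 1 ≤ m) {g : ℝ → ℝ} {x a b c : ℝ} (hx : x ∈ Set.Icc (0 : ℝ) 1)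
    (hg : ∀ p ∈ Set.Icc (0 : ℝ) 1, g p ≤ a + b * (p - x) + c * (p - x) ^ 2) :
    Bpoly m g x ≤ a + c * (x * (1 - x) / m) := by
  calc Bpoly m g x
      ≤ ∑ k ∈ Finset.range (m + 1),
          (a + b * ((k : ℝ) / m - x) + c * ((k : ℝ) / m - x) ^ 2) * bern m k x :=
        Finset.sum_le_sum fun k hk =>
          mul_le_mul_of_nonneg_right (hg _ (div_mem_Icc_of_mem_range hm hk)) (bern_nonneg hx m k)
    _ = a + c * (x * (1 - x) / m) := by
        simp_rw [add_mul, Finset.sum_add_distrib, mul_assoc, ← Finset.mul_sum, sum_bern,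
          sum_sub_mul_bern hm, sum_sq_mul_bern hm]
        ring

lemma sigm_pos {x : ℝ} (hx : x ∈ Set.Ioo (0 : ℝ) 1) : 0 < sigm x :=
  Real.sqrt_pos.2 (mul_pos hx.1 (sub_pos.2 hx.2))

lemma Bpoly_sub_le {f : ℝ → ℝ} (hf : ContinuousOn f (Set.Icc 0 1)) {m : ℕ} (hm : 1 ≤ m) {W : ℝ}
    (hW0 : 0 ≤ W)
    (hW : ∀ t s, 0 ≤ s → s ≤ 1 / Real.sqrt m * sigm t → 0 ≤ t - s → t + s ≤ 1 →
      f (t + s) - 2 * f t + f (t - s) ≤ W)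
    {x : ℝ} (hx : x ∈ Set.Ioo (0 : ℝ) 1) : Bpoly m f x - f x ≤ 2 * W := by
  have hm' : (0 : ℝ) < m := by positivity
  set g : ℝ → ℝ := fun t => f t - W * m * negEntropy t with hg
  have hgc : ContinuousOn g (Set.Icc 0 1) :=
    hf.sub (continuous_const.mul continuous_negEntropy).continuousOn
  have hdiff : ∀ t s, 0 ≤ s → s ≤ 1 / Real.sqrt m * sigm t → 0 ≤ t - s → t + s ≤ 1 → 0 < t →
      t < 1 → g (t + s) - 2 * g t + g (t - s) ≤ W - W * m * (s ^ 2 / (t * (1 - t))) := by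
    intro t s hs hst h0 h1 ht0 ht1
    have ha := hW t s hs hst h0 h1
    have hb := mul_le_mul_of_nonneg_left (sq_div_le_negEntropy_second_diff ht0 ht1 hs
      (by linarith) (by linarith)) (mul_nonneg hW0 hm'.le)
    simp only [hg]
    linarith
  have hchord : ∀ y z, 0 ≤ y → y < x → x < z → z ≤ 1 →
      (z - x) * (g y - g x - W) + (x - y) * (g z - g x - W) ≤ 0 := by
    intro y z hy hyx hxz hz
    have hyz : y < z := hyx.trans hxz
    have h := chord_sub_le (ρ := fun t => 1 / Real.sqrt m * sigm t) hyz
      (hgc.mono (Set.Icc_subset_Icc hy hz)) hW0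
      (fun t ht => mul_pos (by positivity) (sigm_pos ⟨by linarith [ht.1], by linarith [ht.2]⟩))
      (fun t s hs hst h0 h1 => by
        rcases hs.eq_or_lt with rfl | hs'
        · simp only [add_zero, sub_zero]
          linarith
        have := hdiff t s hs hst (by linarith) (by linarith) (by linarith) (by linarith)
        have h2 : 0 ≤ W * m * (s ^ 2 / (t * (1 - t))) := by
          have : 0 < t * (1 - t) := mul_pos (by linarith) (by linarith)
          positivity
        linarith)
      (fun t h0 h1 hpos => by
        have ht0 : 0 < t := by linarith
        have ht1 : t < 1 := by linarith
        have := hdiff t _ hpos.le le_rfl (by linarith) (by linarith) ht0 ht1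
        have ht : 0 < t * (1 - t) := mul_pos ht0 (by linarith)
        have hval : W * m * ((1 / Real.sqrt m * sigm t) ^ 2 / (t * (1 - t))) = W := by
          have ht1' : 1 - t ≠ 0 := by linarith
          rw [mul_pow, div_pow, sigm, Real.sq_sqrt hm'.le, Real.sq_sqrt ht.le]
          field_simp
        linarith)
      ⟨hyx.le, hxz.le⟩
    have hpos : 0 < z - y := sub_pos.2 hyz
    have h' := mul_le_mul_of_nonneg_left h hpos.le
    have heq : (z - y) * (g y + (g z - g y) / (z - y) * (x - y) - g x)
        = (z - y) * g y + (g z - g y) * (x - y) - (z - y) * g x := by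
      field_simp
    rw [heq] at h'
    linarith
  obtain ⟨a, ha⟩ := exists_forall_le_mul_sub (G := fun y => g y - g x - W) hx.1 hx.2
    (by simpa using hW0) hchord
  have hq : 0 < x * (1 - x) := mul_pos hx.1 (sub_pos.2 hx.2)
  have hB := Bpoly_le_of_le (g := f) (a := f x + W)
    (b := a + W * m * (Real.log x - Real.log (1 - x))) (c := W * m / (x * (1 - x)))
    hm (Set.Ioo_subset_Icc_self hx) (fun p hp => by
      have h1 := ha p hp
      have h2 := mul_le_mul_of_nonneg_left (negEntropy_le hx.1 hx.2 hp.1 hp.2)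
        (mul_nonneg hW0 hm'.le)
      simp only [hg] at h1
      rw [div_mul_eq_mul_div, mul_div_assoc]
      linarith)
  have hval : W * m / (x * (1 - x)) * (x * (1 - x) / m) = W := by
    have hx0 := hx.1.ne'
    have hx1 : 1 - x ≠ 0 := (sub_pos.2 hx.2).ne'
    field_simp
  rw [hval] at hB
  linarith

lemma Bpoly_zero {m : ℕ} (f : ℝ → ℝ) : Bpoly m f 0 = f 0 := by
  unfold Bpoly
  rw [Finset.sum_eq_single 0]
  · simp [bern]
  · intro k _ hk
    simp [bern, hk]
  · simp

lemma Bpoly_one {m : ℕ} (hm : 1 ≤ m) (f : ℝ → ℝ) : Bpoly m f 1 = f 1 := by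
  have hm' : (m : ℝ) ≠ 0 := by positivity
  unfold Bpoly
  rw [Finset.sum_eq_single m]
  · simp [bern, hm']
  · intro k hk hkm
    have : m - k ≠ 0 := by
      have := Finset.mem_range.1 hk
      omega
    simp [bern, this]
  · simp

lemma Bpoly_neg (m : ℕ) (f : ℝ → ℝ) (x : ℝ) : Bpoly m (fun t => -f t) x = -Bpoly m f x := by
  simp [Bpoly]

lemma omega2DT_nonneg (f : ℝ → ℝ) (δ : ℝ) : 0 ≤ omega2DT f δ := by
  apply Real.sSup_nonneg
  rintro _ ⟨x, h, -, -, -, -, rfl⟩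
  exact abs_nonneg _

lemma abs_second_diff_le_omega2DT {f : ℝ → ℝ} (hf : ContinuousOn f (Set.Icc 0 1)) {δ t s : ℝ}
    (hδ : 0 ≤ δ) (hs : 0 ≤ s) (hst : s ≤ δ * sigm t) (h0 : 0 ≤ t - s) (h1 : t + s ≤ 1) :
    |f (t + s) - 2 * f t + f (t - s)| ≤ omega2DT f δ := by
  obtain ⟨C, hC⟩ := isCompact_Icc.exists_bound_of_continuousOn hf
  simp only [Real.norm_eq_abs] at hC
  apply le_csSup
  · refine ⟨4 * C, ?_⟩
    rintro _ ⟨x, h, hh, -, ha, hb, rfl⟩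
    have hσ : 0 ≤ h * sigm x := mul_nonneg hh (Real.sqrt_nonneg _)
    have e1 := abs_le.1 (hC _ ha)
    have e2 := abs_le.1 (hC _ hb)
    have e3 := abs_le.1 (hC x ⟨by linarith [ha.1], by linarith [hb.2]⟩)
    rw [abs_le]
    constructor <;> linarith
  · have hnn : 0 ≤ sigm t := Real.sqrt_nonneg _
    have hmul : s / sigm t * sigm t = s := by
      rcases hnn.eq_or_lt with h | h
      · rw [← h] at hst ⊢
        linarith
      · exact div_mul_cancel₀ _ h.ne'
    refine ⟨t, s / sigm t, div_nonneg hs hnn, div_le_of_le_mul₀ hnn hδ hst, ?_, ?_, ?_⟩ <;>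
      rw [hmul]
    · exact ⟨h0, by linarith⟩
    · exact ⟨by linarith, h1⟩

theorem bernstein_uniform_bound (f : ℝ → ℝ) (hf : ContinuousOn f (Set.Icc 0 1))
    (m : ℕ) (hm : 1 ≤ m) :
    (⨆ x : Set.Icc (0:ℝ) 1, |Bpoly m f x - f x|) ≤
      (5 / 2) * omega2DT f (1 / Real.sqrt m) := by
  have hW0 := omega2DT_nonneg f (1 / Real.sqrt m)
  have hW : ∀ t s, 0 ≤ s → s ≤ 1 / Real.sqrt m * sigm t → 0 ≤ t - s → t + s ≤ 1 →
      |f (t + s) - 2 * f t + f (t - s)| ≤ omega2DT f (1 / Real.sqrt m) :=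
    fun t s => abs_second_diff_le_omega2DT hf (by positivity)
  refine ciSup_le fun ⟨x, hx⟩ => ?_
  show |Bpoly m f x - f x| ≤ _
  rcases hx.1.eq_or_lt with rfl | hx0
  · simpa [Bpoly_zero] using hW0
  rcases hx.2.eq_or_lt with rfl | hx1
  · simpa [Bpoly_one hm] using hW0
  have hupper := Bpoly_sub_le hf hm hW0
    (fun t s a b c d => (abs_le.1 (hW t s a b c d)).2) ⟨hx0, hx1⟩
  have hlower := Bpoly_sub_le (f := fun t => -f t) hf.neg hm hW0
    (fun t s a b c d => by linarith [(abs_le.1 (hW t s a b c d)).1]) ⟨hx0, hx1⟩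
  rw [Bpoly_neg] at hlower
  rw [abs_le]
  constructor <;> linarith
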